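/- Let ν ∈ 𝒱₀, let (f1,f2) be a component of an automorphism of Q which is properly resonant with respect to ν, let s1, s2 ≥ 2 be coprime integers with s1·ν(f1) = s2·ν(f2), and let ν0 be the monomial valuation on k[X,Y] with weights (ν(f1), ν(f2)). Then for every nonzero polynomial R ∈ k[X,Y], either ν(R(f1,f2)) = ν0(R), or else ν(R(f1,f2)) > ν0(R) and ν(R(f1,f2)) < min((s1 − 1 − s1/s2)·ν(f1), (s2 − 1 − s2/s1)·ν(f2)). -/

import Mathlib

noncomputable section

open MvPolynomial

/-- The polynomial `q = xt - yz` in `k[x,y,z,t]` (variables `x,y,z,t` are `X 0, X 1, X 2, X 3`). -/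
def qpoly (k : Type) [Field k] : MvPolynomial (Fin 4) k :=
  X 0 * X 3 - X 1 * X 2

/-- The coordinate ring `k[Q] = k[x,y,z,t]/(xt - yz - 1)` of the affine quadric threefold. -/
abbrev QuadRing (k : Type) [Field k] : Type :=
  MvPolynomial (Fin 4) k ⧸ Ideal.span {qpoly k - 1}

/-- The canonical projection `π : k[x,y,z,t] → k[Q]`. -/
def qmk (k : Type) [Field k] : MvPolynomial (Fin 4) k →+* QuadRing k :=
  Ideal.Quotient.mk (Ideal.span {qpoly k - 1})

/-- A valuation on a commutative `k`-algebra `A`, with values in `ℝ ∪ {+∞}`: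
`ν⁻¹({+∞}) = {0}`, `ν(a) = 0` for `a ∈ k*`, `ν(fg) = ν f + ν g`, and
`ν(f + g) ≥ min (ν f) (ν g)`. -/
def IsValuation (k : Type) [Field k] (A : Type) [CommRing A] [Algebra k A]
    (ν : A → WithTop ℝ) : Prop :=
  (∀ f : A, ν f = ⊤ ↔ f = 0) ∧
  (∀ a : k, a ≠ 0 → ν (algebraMap k A a) = 0) ∧
  (∀ f g : A, ν (f * g) = ν f + ν g) ∧
  (∀ f g : A, min (ν f) (ν g) ≤ ν (f + g))

/-- The monomial valuation `ν_p^α` on `k[x,y,z,t]` at the point `p` with weights `α`: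
the minimum of `⟨I, α⟩` over the exponents `I` appearing in the expansion of `R` in the
shifted variables `x - p₀, y - p₁, z - p₂, t - p₃` (and `+∞` on the zero polynomial). -/
def mvalP (k : Type) [Field k] (p : Fin 4 → k) (α : Fin 4 → ℝ)
    (R : MvPolynomial (Fin 4) k) : WithTop ℝ :=
  (MvPolynomial.aeval (fun i => X i + C (p i)) R : MvPolynomial (Fin 4) k).support.inf
    fun I => ((∑ i, α i * (I i : ℝ) : ℝ) : WithTop ℝ)

/-- The monomial valuation `ν_0^α` on `k[x,y,z,t]` at the origin with weights `α`. -/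
def mvalO (k : Type) [Field k] (α : Fin 4 → ℝ)
    (R : MvPolynomial (Fin 4) k) : WithTop ℝ :=
  R.support.inf fun I => ((∑ i, α i * (I i : ℝ) : ℝ) : WithTop ℝ)

/-- The map `ν : k[Q] → ℝ ∪ {+∞}` given by `ν(f) = sup {ν_p^α(R) : π R = f}`. -/
def nuSup (k : Type) [Field k] (p : Fin 4 → k) (α : Fin 4 → ℝ)
    (f : QuadRing k) : WithTop ℝ :=
  sSup {v : WithTop ℝ | ∃ R : MvPolynomial (Fin 4) k, qmk k R = f ∧ mvalP k p α R = v}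

/-- The set `𝒱₀` of valuations on `k[Q]` obtained from monomial valuations at points
`p ∈ k⁴` with weights `α ∈ (ℝ^{<0})⁴` satisfying `α₀ + α₃ = α₁ + α₂`. -/
def V0 (k : Type) [Field k] : Set (QuadRing k → WithTop ℝ) :=
  {ν | ∃ (p : Fin 4 → k) (α : Fin 4 → ℝ),
      (∀ i, α i < 0) ∧ α 0 + α 3 = α 1 + α 2 ∧ ν = nuSup k p α}

/-- The Jacobian determinant `Jac(R₁,R₂,R₃,R₄)` of four polynomials in `k[x,y,z,t]`. -/
def jac (k : Type) [Field k] (R : Fin 4 → MvPolynomial (Fin 4) k) :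
    MvPolynomial (Fin 4) k :=
  (Matrix.of fun i j : Fin 4 => MvPolynomial.pderiv j (R i)).det

/-- The monomial valuation on `k[X,Y]` with weights `w = (w₁, w₂)`. -/
def mval2 (k : Type) [Field k] (w : Fin 2 → ℝ)
    (R : MvPolynomial (Fin 2) k) : WithTop ℝ :=
  R.support.inf fun I => ((∑ i, w i * (I i : ℝ) : ℝ) : WithTop ℝ)

open Classical in
/-- The `(w₁,w₂)`-leading part of `R ∈ k[X,Y]`: the sum of the terms of `R` whose
weighted degree realizes the monomial valuation of `R` with weights `w`. -/
def leadPart2 (k : Type) [Field k] (w : Fin 2 → ℝ) (R : MvPolynomial (Fin 2) k) :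
    MvPolynomial (Fin 2) k :=
  ∑ I ∈ R.support.filter
      (fun I => ((∑ i, w i * (I i : ℝ) : ℝ) : WithTop ℝ) = mval2 k w R),
    monomial I (R.coeff I)

open Classical in
/-- The `α`-leading part `R^w` of `R ∈ k[x,y,z,t]` (with respect to the monomial
valuation at the origin with weights `α`). -/
def leadPart4 (k : Type) [Field k] (α : Fin 4 → ℝ) (R : MvPolynomial (Fin 4) k) :
    MvPolynomial (Fin 4) k :=
  ∑ I ∈ R.support.filter
      (fun I => ((∑ i, α i * (I i : ℝ) : ℝ) : WithTop ℝ) = mvalO k α R),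
    monomial I (R.coeff I)

/-- `(f₁, f₂)` is a component of an automorphism of `Q`: there is a `k`-algebra
automorphism `σ` of `k[Q]` with `σ x = f₁` and `σ y = f₂`. -/
def IsComponent (k : Type) [Field k] (f1 f2 : QuadRing k) : Prop :=
  ∃ σ : QuadRing k ≃ₐ[k] QuadRing k, σ (qmk k (X 0)) = f1 ∧ σ (qmk k (X 1)) = f2

/-- `(f₁, f₂)` is critically resonant with respect to `ν`. -/
def CriticallyResonant (k : Type) [Field k] (ν : QuadRing k → WithTop ℝ)
    (f1 f2 : QuadRing k) : Prop :=
  (∃ (m : ℕ) (lam : k), 1 ≤ m ∧ lam ≠ 0 ∧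
      ν f1 < ν (f1 - algebraMap k (QuadRing k) lam * f2 ^ m) ∧ ν f1 = m • ν f2) ∨
  (∃ (m : ℕ) (lam : k), 1 ≤ m ∧ lam ≠ 0 ∧
      ν f2 < ν (f2 - algebraMap k (QuadRing k) lam * f1 ^ m) ∧ ν f2 = m • ν f1)

section PolyOrd

variable {k : Type} [Field k] {σ : Type} [Fintype σ]

/-- The monomial valuation at the origin with weights `w` on `k[X_σ]`. -/
def polyOrd (w : σ → ℝ) (R : MvPolynomial σ k) : WithTop ℝ :=
  R.support.inf fun I => ((∑ i, w i * (I i : ℝ) : ℝ) : WithTop ℝ)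

theorem le_polyOrd {w : σ → ℝ} {R : MvPolynomial σ k} {c : ℝ} :
    (c : WithTop ℝ) ≤ polyOrd w R ↔ ∀ I, coeff I R ≠ 0 → c ≤ ∑ i, w i * (I i : ℝ) := by
  simp only [polyOrd, Finset.le_inf_iff, mem_support_iff, WithTop.coe_le_coe]

theorem lt_polyOrd {w : σ → ℝ} {R : MvPolynomial σ k} {c : ℝ} :
    (c : WithTop ℝ) < polyOrd w R ↔ ∀ I, coeff I R ≠ 0 → c < ∑ i, w i * (I i : ℝ) := by
  simp only [polyOrd, Finset.lt_inf_iff (WithTop.coe_lt_top c), mem_support_iff,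
    WithTop.coe_lt_coe]

theorem polyOrd_eq_top {w : σ → ℝ} {R : MvPolynomial σ k} : polyOrd w R = ⊤ ↔ R = 0 := by
  simp only [polyOrd, Finset.inf_eq_top_iff, mem_support_iff, WithTop.coe_ne_top,
    MvPolynomial.ext_iff, coeff_zero, imp_false, not_not]

theorem polyOrd_le {w : σ → ℝ} {R : MvPolynomial σ k} {I : σ →₀ ℕ} (h : coeff I R ≠ 0) :
    polyOrd w R ≤ ((∑ i, w i * (I i : ℝ) : ℝ) : WithTop ℝ) :=
  Finset.inf_le (f := fun I : σ →₀ ℕ => ((∑ i, w i * (I i : ℝ) : ℝ) : WithTop ℝ))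
    (mem_support_iff.2 h)

theorem exists_polyOrd_eq {w : σ → ℝ} {R : MvPolynomial σ k} (h : R ≠ 0) :
    ∃ I, coeff I R ≠ 0 ∧ polyOrd w R = ((∑ i, w i * (I i : ℝ) : ℝ) : WithTop ℝ) := by
  obtain ⟨I, hI, h'⟩ := Finset.exists_mem_eq_inf R.support (support_nonempty.2 h)
    fun I : σ →₀ ℕ => ((∑ i, w i * (I i : ℝ) : ℝ) : WithTop ℝ)
  exact ⟨I, mem_support_iff.1 hI, h'⟩

theorem sum_weight_add (w : σ → ℝ) (I J : σ →₀ ℕ) :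
    ∑ i, w i * ((I + J) i : ℝ) = ∑ i, w i * (I i : ℝ) + ∑ i, w i * (J i : ℝ) := by
  simp [mul_add, Finset.sum_add_distrib]

theorem le_polyOrd_add {w : σ → ℝ} {A B : MvPolynomial σ k} {c : ℝ}
    (hA : (c : WithTop ℝ) ≤ polyOrd w A) (hB : (c : WithTop ℝ) ≤ polyOrd w B) :
    (c : WithTop ℝ) ≤ polyOrd w (A + B) := by
  rw [le_polyOrd] at *
  intro I hI
  by_cases h : coeff I A = 0
  · exact hB I fun h' => hI (by simp [h, h'])
  · exact hA I h

theorem le_polyOrd_sum {ι : Type*} {w : σ → ℝ} {s : Finset ι} {A : ι → MvPolynomial σ k} {c : ℝ}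
    (h : ∀ i ∈ s, (c : WithTop ℝ) ≤ polyOrd w (A i)) :
    (c : WithTop ℝ) ≤ polyOrd w (∑ i ∈ s, A i) :=
  Finset.sum_induction _ (fun B => (c : WithTop ℝ) ≤ polyOrd w B)
    (fun _ _ => le_polyOrd_add) (by simp [polyOrd_eq_top.2 rfl]) h

theorem polyOrd_neg (w : σ → ℝ) (A : MvPolynomial σ k) : polyOrd w (-A) = polyOrd w A := by
  simp [polyOrd]

theorem lt_polyOrd_add {w : σ → ℝ} {A B : MvPolynomial σ k} {c : ℝ}
    (hA : (c : WithTop ℝ) < polyOrd w A) (hB : (c : WithTop ℝ) < polyOrd w B) :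
    (c : WithTop ℝ) < polyOrd w (A + B) := by
  rw [lt_polyOrd] at *
  intro I hI
  by_cases h : coeff I A = 0
  · exact hB I fun h' => hI (by simp [h, h'])
  · exact hA I h

theorem le_polyOrd_mul {w : σ → ℝ} {A B : MvPolynomial σ k} {c d : ℝ}
    (hA : (c : WithTop ℝ) ≤ polyOrd w A) (hB : (d : WithTop ℝ) ≤ polyOrd w B) :
    ((c + d : ℝ) : WithTop ℝ) ≤ polyOrd w (A * B) := by
  classical
  rw [le_polyOrd] at *
  intro I hI
  rw [coeff_mul] at hI
  obtain ⟨⟨J, L⟩, hJL, h⟩ := Finset.exists_ne_zero_of_sum_ne_zero hI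
  rw [Finset.HasAntidiagonal.mem_antidiagonal] at hJL
  simp only at hJL h
  rw [← hJL, sum_weight_add]
  exact add_le_add (hA J (left_ne_zero_of_mul h)) (hB L (right_ne_zero_of_mul h))

theorem le_polyOrd_C (w : σ → ℝ) (c : k) : ((0 : ℝ) : WithTop ℝ) ≤ polyOrd w (C c) := by
  classical
  rw [le_polyOrd]
  intro I hI
  rw [coeff_C] at hI
  have : I = 0 := by by_contra h; exact hI (if_neg fun h' => h h'.symm)
  simp [this]

theorem sum_weight_single (w : σ → ℝ) (i : σ) :
    ∑ j, w j * ((Finsupp.single i 1 : σ →₀ ℕ) j : ℝ) = w i := by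
  classical
  simp [Finsupp.single_apply]

theorem polyOrd_X (w : σ → ℝ) (i : σ) : polyOrd w (X i : MvPolynomial σ k) = (w i : WithTop ℝ) := by
  rw [polyOrd, support_X, Finset.inf_singleton, sum_weight_single]

theorem le_polyOrd_pderiv {w : σ → ℝ} {A : MvPolynomial σ k} {c : ℝ} (i : σ)
    (hA : (c : WithTop ℝ) ≤ polyOrd w A) :
    ((c - w i : ℝ) : WithTop ℝ) ≤ polyOrd w (pderiv i A) := by
  rw [le_polyOrd] at *
  intro I hI
  rw [coeff_pderiv] at hI
  have := hA _ (left_ne_zero_of_mul hI)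
  rw [sum_weight_add, sum_weight_single] at this
  linarith

theorem lt_polyOrd_pderiv {w : σ → ℝ} {A : MvPolynomial σ k} {c : ℝ} (i : σ)
    (hA : (c : WithTop ℝ) < polyOrd w A) :
    ((c - w i : ℝ) : WithTop ℝ) < polyOrd w (pderiv i A) := by
  rw [lt_polyOrd] at *
  intro I hI
  rw [coeff_pderiv] at hI
  have := hA _ (left_ne_zero_of_mul hI)
  rw [sum_weight_add, sum_weight_single] at this
  linarith

theorem coeff_component [DecidableEq ℝ] (w : σ → ℝ) (c : ℝ) (A : MvPolynomial σ k) (I : σ →₀ ℕ) :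
    coeff I (weightedHomogeneousComponent w c A) =
      if ∑ i, w i * (I i : ℝ) = c then coeff I A else 0 := by
  have : Finsupp.weight w I = ∑ i, w i * (I i : ℝ) := by
    rw [Finsupp.weight_apply, Finsupp.sum_fintype _ _ (by simp)]
    simp [mul_comm]
  rw [coeff_weightedHomogeneousComponent, this]

theorem component_eq_zero {w : σ → ℝ} {c : ℝ} {A : MvPolynomial σ k}
    (h : (c : WithTop ℝ) < polyOrd w A) : weightedHomogeneousComponent w c A = 0 := by
  classical
  ext I
  rw [coeff_component, coeff_zero]
  split_ifs with hI
  · by_contra h'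
    exact absurd (lt_polyOrd.1 h I h') (by simp [hI])
  · rfl

theorem lt_polyOrd_sub_component {w : σ → ℝ} {c : ℝ} {A : MvPolynomial σ k}
    (h : (c : WithTop ℝ) ≤ polyOrd w A) :
    (c : WithTop ℝ) < polyOrd w (A - weightedHomogeneousComponent w c A) := by
  classical
  rw [lt_polyOrd]
  intro I hI
  rw [coeff_sub, coeff_component] at hI
  split_ifs at hI with h'
  · simp at hI
  · exact lt_of_le_of_ne (le_polyOrd.1 h I (by simpa using hI)) (Ne.symm h')

theorem lt_polyOrd_of_component_eq_zero {w : σ → ℝ} {c : ℝ} {A : MvPolynomial σ k}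
    (h : (c : WithTop ℝ) ≤ polyOrd w A) (h0 : weightedHomogeneousComponent w c A = 0) :
    (c : WithTop ℝ) < polyOrd w A := by
  simpa [h0] using lt_polyOrd_sub_component h

theorem component_mul {w : σ → ℝ} {c d : ℝ} {A B : MvPolynomial σ k}
    (hA : (c : WithTop ℝ) ≤ polyOrd w A) (hB : (d : WithTop ℝ) ≤ polyOrd w B) :
    weightedHomogeneousComponent w (c + d) (A * B) =
      weightedHomogeneousComponent w c A * weightedHomogeneousComponent w d B := by
  classical
  rw [le_polyOrd] at *
  ext I
  have hs (p : Prop) [Decidable p] (s : Finset ((σ →₀ ℕ) × (σ →₀ ℕ)))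
      (f : (σ →₀ ℕ) × (σ →₀ ℕ) → k) :
      (if p then ∑ x ∈ s, f x else 0) = ∑ x ∈ s, if p then f x else 0 := by
    split_ifs <;> simp
  rw [coeff_component, coeff_mul, coeff_mul, hs]
  refine Finset.sum_congr rfl ?_
  rintro ⟨J, L⟩ hJL
  rw [Finset.HasAntidiagonal.mem_antidiagonal] at hJL
  simp only at hJL ⊢
  rw [coeff_component, coeff_component, ← hJL, sum_weight_add]
  by_cases h1 : coeff J A = 0
  · simp [h1]
  by_cases h2 : coeff L B = 0
  · simp [h2]
  have h3 := hA J h1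
  have h4 := hB L h2
  split_ifs with h5 h6 h7 h7 <;> first | rfl | simp
  all_goals exfalso
  all_goals first | exact h6 (by linarith) | exact h7 (by linarith) | exact h5 (by linarith)

theorem le_polyOrd_of_mul {w : σ → ℝ} {c d : ℝ} {A B : MvPolynomial σ k}
    (hA : (d : WithTop ℝ) ≤ polyOrd w A) (h0 : weightedHomogeneousComponent w d A ≠ 0)
    (h : (c : WithTop ℝ) ≤ polyOrd w (A * B)) :
    ((c - d : ℝ) : WithTop ℝ) ≤ polyOrd w B := by
  by_contra! hm
  have hB0 : B ≠ 0 := fun h0 => by simp [h0, polyOrd_eq_top.2] at hm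
  obtain ⟨I, hI, hI'⟩ := exists_polyOrd_eq (w := w) hB0
  set m := ∑ i, w i * (I i : ℝ)
  rw [hI', WithTop.coe_lt_coe] at hm
  have h1 := component_mul hA hI'.ge
  have h2 : weightedHomogeneousComponent w (d + m) (A * B) = 0 :=
    component_eq_zero (lt_of_lt_of_le (b := (c : WithTop ℝ)) (by exact_mod_cast by linarith) h)
  rw [h2] at h1
  exact (lt_polyOrd_of_component_eq_zero hI'.ge
    ((mul_eq_zero.1 h1.symm).resolve_left h0)).ne' hI'

end PolyOrd

section NuSup

variable {k : Type} [Field k]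

theorem prime_qpoly : Prime (qpoly k) := by
  rw [← irreducible_iff_prime]
  have h : qpoly k = X 0 * X 3 + -(X 1 * X 2) := by rw [qpoly, sub_eq_add_neg]
  rw [h]
  have hvars : (-(X 1 * X 2) : MvPolynomial (Fin 4) k).vars ⊆ {1, 2} := by
    classical
    rw [vars_neg]
    exact (vars_mul _ _).trans (by simp [vars_X])
  refine irreducible_mul_X_add _ _ 3 (X_ne_zero 0) (by simp [vars_X]) (fun h3 => ?_) ?_
  · have := hvars h3
    simp at this
  · refine (X_prime (i := (0 : Fin 4)) (R := k)).irreducible.isRelPrime_iff_not_dvd.2 fun hd => ?_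
    rw [dvd_neg] at hd
    rcases (X_prime (i := (0 : Fin 4)) (R := k)).dvd_or_dvd hd with hd | hd <;> simp [X_dvd_X] at hd

theorem polyOrd_shift_le {α : Fin 4 → ℝ} (hα : ∀ i, α i < 0) (p : Fin 4 → k) {c : ℝ}
    {R : MvPolynomial (Fin 4) k} (h : (c : WithTop ℝ) ≤ polyOrd α R) :
    (c : WithTop ℝ) ≤
      polyOrd α (aeval (fun i => X i + C (p i)) R : MvPolynomial (Fin 4) k) := by
  rw [aeval_def, eval₂_eq', MvPolynomial.algebraMap_eq]
  refine le_polyOrd_sum fun I hI => ?_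
  have hc := le_polyOrd.1 h I (mem_support_iff.1 hI)
  have hX (i : Fin 4) (n : ℕ) : ((α i * n : ℝ) : WithTop ℝ) ≤
      polyOrd α ((X i + C (p i)) ^ n : MvPolynomial (Fin 4) k) := by
    induction n with
    | zero => simpa using le_polyOrd_C α (1 : k)
    | succ n ih =>
      rw [pow_succ, Nat.cast_succ, mul_add, mul_one]
      refine le_polyOrd_mul ih (le_polyOrd_add (polyOrd_X α i).ge ?_)
      exact le_trans (by exact_mod_cast (hα i).le) (le_polyOrd_C α (p i))
  have hP : ((∑ i, α i * (I i : ℝ) : ℝ) : WithTop ℝ) ≤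
      polyOrd α (∏ i, (X i + C (p i)) ^ I i : MvPolynomial (Fin 4) k) := by
    rw [Fin.sum_univ_four, Fin.prod_univ_four]
    exact le_polyOrd_mul (le_polyOrd_mul (le_polyOrd_mul (hX _ _) (hX _ _)) (hX _ _)) (hX _ _)
  have := le_polyOrd_mul (le_polyOrd_C α (coeff I R)) hP
  rw [zero_add] at this
  exact (WithTop.coe_le_coe.2 hc).trans this

theorem mvalP_eq {α : Fin 4 → ℝ} (hα : ∀ i, α i < 0) (p : Fin 4 → k)
    (R : MvPolynomial (Fin 4) k) : mvalP k p α R = polyOrd α R := by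
  change polyOrd α _ = _
  have h1 (p : Fin 4 → k) (R : MvPolynomial (Fin 4) k) :
      polyOrd α R ≤ polyOrd α (aeval (fun i => X i + C (p i)) R : MvPolynomial (Fin 4) k) := by
    by_cases hR : R = 0
    · simp [hR]
    obtain ⟨I, -, hI⟩ := exists_polyOrd_eq (w := α) hR
    rw [hI]
    exact polyOrd_shift_le hα p hI.ge
  refine le_antisymm ?_ (h1 p R)
  refine (h1 (fun i => - p i) _).trans (le_of_eq ?_)
  congr 1
  rw [← AlgHom.comp_apply]
  conv_rhs => rw [← AlgHom.id_apply (R := k) R]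
  congr 1
  ext i : 1
  simp

theorem polyOrd_le_zero {α : Fin 4 → ℝ} (hα : ∀ i, α i < 0) {R : MvPolynomial (Fin 4) k}
    (h : R ≠ 0) : polyOrd α R ≤ ((0 : ℝ) : WithTop ℝ) := by
  obtain ⟨I, -, hI⟩ := exists_polyOrd_eq (w := α) h
  rw [hI, WithTop.coe_le_coe]
  exact Finset.sum_nonpos fun i _ => mul_nonpos_of_nonpos_of_nonneg (hα i).le (Nat.cast_nonneg _)

theorem qmk_eq_qmk {A B : MvPolynomial (Fin 4) k} :
    qmk k A = qmk k B ↔ ∃ S, A = B + (qpoly k - 1) * S := by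
  rw [qmk, Ideal.Quotient.eq, Ideal.mem_span_singleton]
  exact ⟨fun ⟨S, hS⟩ => ⟨S, by rw [← hS]; ring⟩, fun ⟨S, hS⟩ => ⟨S, by rw [hS]; ring⟩⟩

theorem qmk_surjective : Function.Surjective (qmk k) := Ideal.Quotient.mk_surjective

variable {α : Fin 4 → ℝ} (hα : ∀ i, α i < 0) (hq : α 0 + α 3 = α 1 + α 2)
include hα hq

theorem component_qpoly_sub_one :
    ((α 0 + α 3 : ℝ) : WithTop ℝ) ≤ polyOrd α (qpoly k - 1) ∧
      weightedHomogeneousComponent α (α 0 + α 3) (qpoly k - 1) = qpoly k := by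
  have hX (i : Fin 4) := (polyOrd_X (k := k) α i).ge
  have hXX (i j : Fin 4) := le_polyOrd_mul (hX i) (hX j)
  have hX' (i : Fin 4) : weightedHomogeneousComponent α (α i) (X i : MvPolynomial (Fin 4) k) = X i :=
    (isWeightedHomogeneous_X k α i).weightedHomogeneousComponent_same
  have h1 : ((α 0 + α 3 : ℝ) : WithTop ℝ) < polyOrd α (-1 : MvPolynomial (Fin 4) k) := by
    rw [polyOrd_neg]
    refine lt_of_lt_of_le ?_ (le_polyOrd_C α (1 : k))
    exact_mod_cast add_neg (hα 0) (hα 3)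
  have h2 : ((α 0 + α 3 : ℝ) : WithTop ℝ) ≤ polyOrd α (-(X 1 * X 2) : MvPolynomial (Fin 4) k) := by
    rw [polyOrd_neg, hq]
    exact hXX 1 2
  constructor
  · rw [qpoly, sub_eq_add_neg, sub_eq_add_neg]
    exact le_polyOrd_add (le_polyOrd_add (hXX 0 3) h2) h1.le
  · have h3 : weightedHomogeneousComponent α (α 0 + α 3) (1 : MvPolynomial (Fin 4) k) = 0 := by
      rw [polyOrd_neg] at h1
      exact component_eq_zero h1
    rw [map_sub, h3, sub_zero, qpoly, map_sub, component_mul (hX 0) (hX 3), hq,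
      component_mul (hX 1) (hX 2)]
    simp only [hX']

theorem polyOrd_le_of_not_dvd {c : ℝ} {R R' : MvPolynomial (Fin 4) k}
    (hR : (c : WithTop ℝ) ≤ polyOrd α R)
    (hd : ¬ qpoly k ∣ weightedHomogeneousComponent α c R) (h : qmk k R' = qmk k R) :
    polyOrd α R' ≤ c := by
  by_contra! hlt
  obtain ⟨hq1, hq2⟩ := component_qpoly_sub_one (k := k) hα hq
  obtain ⟨S, hS⟩ := qmk_eq_qmk.1 h
  have hcomp : weightedHomogeneousComponent α c ((qpoly k - 1) * S)
      = - weightedHomogeneousComponent α c R := by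
    have := congrArg (weightedHomogeneousComponent α c) hS
    rw [component_eq_zero hlt, map_add] at this
    exact (neg_eq_of_add_eq_zero_right this.symm).symm
  have hmS : ((c - (α 0 + α 3) : ℝ) : WithTop ℝ) ≤ polyOrd α S := by
    refine le_polyOrd_of_mul hq1 (by rw [hq2]; exact prime_qpoly.ne_zero) ?_
    have : (qpoly k - 1) * S = R' + -R := by rw [hS]; ring
    rw [this]
    exact le_polyOrd_add hlt.le (by rwa [polyOrd_neg])
  have h1 := component_mul hq1 hmS
  rw [hq2, add_sub_cancel, hcomp] at h1
  exact hd ((dvd_neg).1 (h1 ▸ dvd_mul_right _ _))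

theorem exists_not_dvd_component {f : QuadRing k} (hf : f ≠ 0) :
    ∃ (R : MvPolynomial (Fin 4) k) (c : ℝ), qmk k R = f ∧ polyOrd α R = c ∧
      ¬ qpoly k ∣ weightedHomogeneousComponent α c R := by
  obtain ⟨hq1, hq2⟩ := component_qpoly_sub_one (k := k) hα hq
  obtain ⟨R₀, hR₀⟩ := qmk_surjective f
  have hne {R : MvPolynomial (Fin 4) k} (hR : qmk k R = f) : R ≠ 0 := by
    rintro rfl
    exact hf (by rw [← hR, map_zero])
  obtain ⟨I₀, -, hI₀⟩ := exists_polyOrd_eq (w := α) (hne hR₀)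
  set c₀ := ∑ i, α i * (I₀ i : ℝ)
  have hfin : {I : Fin 4 →₀ ℕ | c₀ ≤ ∑ i, α i * (I i : ℝ)}.Finite := by
    refine (Set.finite_Iic (Finsupp.equivFunOnFinite.symm fun i => ⌈c₀ / α i⌉₊)).subset ?_
    intro I hI i
    have h1 : ∑ j, α j * (I j : ℝ) ≤ α i * I i := by
      have := Finset.single_le_sum (f := fun j => -(α j * (I j : ℝ))) (s := Finset.univ)
        (fun j _ => neg_nonneg.2 (mul_nonpos_of_nonpos_of_nonneg (hα j).le (Nat.cast_nonneg _)))
        (Finset.mem_univ i)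
      rw [Finset.sum_neg_distrib] at this
      exact neg_le_neg_iff.1 this
    have h2 : (I i : ℝ) ≤ c₀ / α i := by
      rw [le_div_iff_of_neg (hα i), mul_comm]
      exact le_trans hI h1
    simpa using Nat.cast_le.1 (h2.trans (Nat.le_ceil _))
  let V : Set (Fin 4 →₀ ℕ) := {I | c₀ ≤ ∑ i, α i * (I i : ℝ) ∧
    ∃ R : MvPolynomial (Fin 4) k, qmk k R = f ∧
      polyOrd α R = ((∑ i, α i * (I i : ℝ) : ℝ) : WithTop ℝ)}
  obtain ⟨I, ⟨hI, R, hR, hRI⟩, hmax⟩ := Set.exists_max_image V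
    (fun I => ∑ i, α i * (I i : ℝ)) (hfin.subset fun I hI => hI.1) ⟨I₀, le_rfl, R₀, hR₀, hI₀⟩
  refine ⟨R, _, hR, hRI, ?_⟩
  set c := ∑ i, α i * (I i : ℝ)
  rintro ⟨S, hS⟩
  have hqS : ((α 0 + α 3 : ℝ) : WithTop ℝ) ≤ polyOrd α (qpoly k) ∧
      weightedHomogeneousComponent α (α 0 + α 3) (qpoly k) ≠ 0 := by
    have h1 : ((α 0 + α 3 : ℝ) : WithTop ℝ) < polyOrd α (1 : MvPolynomial (Fin 4) k) := by
      refine lt_of_lt_of_le ?_ (le_polyOrd_C α (1 : k))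
      exact_mod_cast add_neg (hα 0) (hα 3)
    have h2 : qpoly k = (qpoly k - 1) + 1 := by ring
    constructor
    · rw [h2]
      exact le_polyOrd_add hq1 h1.le
    · rw [h2, map_add, hq2, component_eq_zero h1, add_zero]
      exact prime_qpoly.ne_zero
  have hcS : (c : WithTop ℝ) < polyOrd α S := by
    refine lt_of_lt_of_le ?_ (le_polyOrd_of_mul (c := c) hqS.1 hqS.2 ?_)
    · exact_mod_cast by linarith [hα 0, hα 3]
    · rw [← hS]
      have := le_polyOrd_add hRI.ge
        (B := -(R - weightedHomogeneousComponent α c R))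
        (by rw [polyOrd_neg]; exact (lt_polyOrd_sub_component hRI.ge).le)
      simpa using this
  have hR' : qmk k (R - (qpoly k - 1) * S) = f := by
    rw [← hR, qmk_eq_qmk]
    exact ⟨-S, by ring⟩
  have hlt : (c : WithTop ℝ) < polyOrd α (R - (qpoly k - 1) * S) := by
    have : R - (qpoly k - 1) * S = (R - weightedHomogeneousComponent α c R) + S := by
      rw [hS]; ring
    rw [this]
    exact lt_polyOrd_add (lt_polyOrd_sub_component hRI.ge) hcS
  obtain ⟨I', -, hI'⟩ := exists_polyOrd_eq (w := α) (hne hR')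
  rw [hI', WithTop.coe_lt_coe] at hlt
  exact absurd (hmax I' ⟨hI.trans hlt.le, _, hR', hI'⟩) (not_le.2 hlt)

theorem nuSup_eq_of_not_dvd (p : Fin 4 → k) {R : MvPolynomial (Fin 4) k} {c : ℝ}
    (hR : polyOrd α R = c) (hd : ¬ qpoly k ∣ weightedHomogeneousComponent α c R) :
    nuSup k p α (qmk k R) = c := by
  have hub : (c : WithTop ℝ) ∈ upperBounds
      {v : WithTop ℝ | ∃ R', qmk k R' = qmk k R ∧ mvalP k p α R' = v} := by
    rintro v ⟨R', h, rfl⟩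
    rw [mvalP_eq hα]
    exact polyOrd_le_of_not_dvd hα hq hR.ge hd h
  have hmem : (c : WithTop ℝ) ∈
      {v : WithTop ℝ | ∃ R', qmk k R' = qmk k R ∧ mvalP k p α R' = v} :=
    ⟨R, rfl, by rw [mvalP_eq hα, hR]⟩
  exact (WithTop.isLUB_sSup' ⟨_, hmem⟩).unique ⟨hub, fun u hu => hu hmem⟩

theorem exists_nuSup_eq (p : Fin 4 → k) {f : QuadRing k} (hf : f ≠ 0) :
    ∃ (R : MvPolynomial (Fin 4) k) (c : ℝ), qmk k R = f ∧ polyOrd α R = c ∧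
      ¬ qpoly k ∣ weightedHomogeneousComponent α c R ∧ nuSup k p α f = c := by
  obtain ⟨R, c, rfl, hR, hd⟩ := exists_not_dvd_component hα hq hf
  exact ⟨R, c, rfl, hR, hd, nuSup_eq_of_not_dvd hα hq p hR hd⟩

omit hq in
theorem nuSup_zero (p : Fin 4 → k) : nuSup k p α 0 = ⊤ :=
  WithTop.sSup_of_top_mem ⟨0, map_zero _, by rw [mvalP_eq hα, polyOrd_eq_top.2 rfl]⟩

theorem polyOrd_le_nuSup (p : Fin 4 → k) (R : MvPolynomial (Fin 4) k) :
    polyOrd α R ≤ nuSup k p α (qmk k R) := by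
  by_cases h : qmk k R = 0
  · rw [h, nuSup_zero hα]
    exact le_top
  obtain ⟨R', c, h1, h2, h3, h4⟩ := exists_nuSup_eq hα hq p h
  rw [h4]
  exact polyOrd_le_of_not_dvd hα hq h2.ge h3 h1.symm

theorem nuSup_eq_top (p : Fin 4 → k) (f : QuadRing k) : nuSup k p α f = ⊤ ↔ f = 0 := by
  refine ⟨fun h => ?_, fun h => h ▸ nuSup_zero hα p⟩
  by_contra hf
  obtain ⟨R, c, -, -, -, h4⟩ := exists_nuSup_eq hα hq p hf
  simp [h4] at h

theorem nuSup_mul (p : Fin 4 → k) (f g : QuadRing k) :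
    nuSup k p α (f * g) = nuSup k p α f + nuSup k p α g := by
  by_cases hf : f = 0
  · simp [hf, nuSup_zero hα]
  by_cases hg : g = 0
  · simp [hg, nuSup_zero hα]
  obtain ⟨R, c, rfl, h2, h3, h4⟩ := exists_nuSup_eq hα hq p hf
  obtain ⟨R', c', rfl, h2', h3', h4'⟩ := exists_nuSup_eq hα hq p hg
  have hcomp := component_mul h2.ge h2'.ge
  have hd : ¬ qpoly k ∣ weightedHomogeneousComponent α (c + c') (R * R') := by
    rw [hcomp]
    exact fun h => (prime_qpoly.dvd_or_dvd h).elim h3 h3'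
  have hle := le_polyOrd_mul h2.ge h2'.ge
  have heq : polyOrd α (R * R') = ((c + c' : ℝ) : WithTop ℝ) := by
    refine le_antisymm (polyOrd_le_of_not_dvd hα hq hle hd rfl) hle
  rw [h4, h4', ← map_mul, nuSup_eq_of_not_dvd hα hq p heq hd, WithTop.coe_add]

theorem le_nuSup_add (p : Fin 4 → k) (f g : QuadRing k) :
    min (nuSup k p α f) (nuSup k p α g) ≤ nuSup k p α (f + g) := by
  by_cases hf : f = 0
  · simp [hf]
  by_cases hg : g = 0
  · simp [hg]
  obtain ⟨R, c, rfl, h2, h3, h4⟩ := exists_nuSup_eq hα hq p hf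
  obtain ⟨R', c', rfl, h2', h3', h4'⟩ := exists_nuSup_eq hα hq p hg
  rw [h4, h4', ← map_add, ← WithTop.coe_min]
  refine le_trans (le_polyOrd_add ?_ ?_) (polyOrd_le_nuSup hα hq p _)
  · rw [h2]; exact_mod_cast min_le_left _ _
  · rw [h2']; exact_mod_cast min_le_right _ _

theorem nuSup_le_zero (p : Fin 4 → k) {f : QuadRing k} (hf : f ≠ 0) :
    nuSup k p α f ≤ ((0 : ℝ) : WithTop ℝ) := by
  obtain ⟨R, c, rfl, h2, -, h4⟩ := exists_nuSup_eq hα hq p hf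
  rw [h4, ← h2]
  exact polyOrd_le_zero hα fun h => hf (by rw [h, map_zero])

theorem nuSup_algebraMap (p : Fin 4 → k) {c : k} (hc : c ≠ 0) :
    nuSup k p α (algebraMap k (QuadRing k) c) = 0 := by
  have hne (u : k) (hu : u ≠ 0) : algebraMap k (QuadRing k) u ≠ 0 := by
    have : algebraMap k (QuadRing k) u = qmk k (C u) := rfl
    rw [this, Ne, ← map_zero (qmk k), qmk_eq_qmk]
    rintro ⟨S, hS⟩
    have h0 := congrArg (MvPolynomial.eval ![1, 0, 0, 1]) hS
    simp [qpoly] at h0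
    exact hu h0
  have h (u : k) (hu : u ≠ 0) : nuSup k p α (algebraMap k (QuadRing k) u) = 0 :=
    le_antisymm (nuSup_le_zero hα hq p (hne u hu))
      ((le_polyOrd_C α u).trans (polyOrd_le_nuSup hα hq p (C u)))
  exact h c hc

theorem isValuation_nuSup (p : Fin 4 → k) : IsValuation k (QuadRing k) (nuSup k p α) :=
  ⟨nuSup_eq_top hα hq p, fun _ => nuSup_algebraMap hα hq p, nuSup_mul hα hq p,
    le_nuSup_add hα hq p⟩

theorem eq_algebraMap_of_nuSup_eq_zero (p : Fin 4 → k) {f : QuadRing k}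
    (hf : nuSup k p α f = ((0 : ℝ) : WithTop ℝ)) : ∃ c, f = algebraMap k (QuadRing k) c := by
  have hf0 : f ≠ 0 := by
    rintro rfl
    simp [nuSup_zero hα] at hf
  obtain ⟨R, c, rfl, h2, -, h4⟩ := exists_nuSup_eq hα hq p hf0
  rw [h4, ← h2] at hf
  refine ⟨coeff 0 R, ?_⟩
  have : R = C (coeff 0 R) := by
    classical
    ext I
    rw [coeff_C]
    split_ifs with hI
    · rw [hI]
    · by_contra h
      have h0 := le_polyOrd.1 hf.ge I h
      obtain ⟨i, hi⟩ : ∃ i, I i ≠ 0 := by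
        by_contra! h'
        exact hI (Finsupp.ext fun i => (h' i).symm)
      refine absurd h0 (not_le.2 (Finset.sum_neg' (fun j _ => ?_) ⟨i, Finset.mem_univ i, ?_⟩))
      · exact mul_nonpos_of_nonpos_of_nonneg (hα j).le (Nat.cast_nonneg _)
      · exact mul_neg_of_neg_of_pos (hα i) (by exact_mod_cast Nat.pos_of_ne_zero hi)
  conv_lhs => rw [this]
  rfl

end NuSup

section Gradient

variable {k : Type} [Field k]

/-- The gradient of a polynomial, restricted to the quadric. -/
def quadGrad (A : MvPolynomial (Fin 4) k) (j : Fin 4) : QuadRing k := qmk k (pderiv j A)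

/-- The determinant of four vectors of length four. -/
def vol {K : Type} [CommRing K] (r u v w : Fin 4 → K) : K := (Matrix.of ![r, u, v, w]).det

theorem vol_eq {K : Type} [CommRing K] (r u v w : Fin 4 → K) : vol r u v w =
    r 0 * (u 1 * (v 2 * w 3 - v 3 * w 2) - u 2 * (v 1 * w 3 - v 3 * w 1)
      + u 3 * (v 1 * w 2 - v 2 * w 1))
    - r 1 * (u 0 * (v 2 * w 3 - v 3 * w 2) - u 2 * (v 0 * w 3 - v 3 * w 0)
      + u 3 * (v 0 * w 2 - v 2 * w 0))
    + r 2 * (u 0 * (v 1 * w 3 - v 3 * w 1) - u 1 * (v 0 * w 3 - v 3 * w 0)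
      + u 3 * (v 0 * w 1 - v 1 * w 0))
    - r 3 * (u 0 * (v 1 * w 2 - v 2 * w 1) - u 1 * (v 0 * w 2 - v 2 * w 0)
      + u 2 * (v 0 * w 1 - v 1 * w 0)) := by
  simp [vol, Matrix.det_succ_row_zero, Fin.sum_univ_succ, Fin.succAbove]
  ring

theorem le_polyOrd_det {α m : Fin 4 → ℝ} {M : Matrix (Fin 4) (Fin 4) (MvPolynomial (Fin 4) k)}
    (h : ∀ i j, ((m i - α j : ℝ) : WithTop ℝ) ≤ polyOrd α (M i j)) :
    ((∑ i, m i - ∑ i, α i : ℝ) : WithTop ℝ) ≤ polyOrd α M.det := by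
  rw [Matrix.det_apply]
  refine le_polyOrd_sum fun s _ => ?_
  have h1 : ((∑ i, m i - ∑ i, α i : ℝ) : WithTop ℝ) ≤ polyOrd α (∏ i, M (s i) i) := by
    rw [← Equiv.sum_comp s m, ← Finset.sum_sub_distrib, Fin.sum_univ_four, Fin.prod_univ_four]
    exact le_polyOrd_mul (le_polyOrd_mul (le_polyOrd_mul (h _ _) (h _ _)) (h _ _)) (h _ _)
  rcases Int.units_eq_one_or (Equiv.Perm.sign s) with hs | hs
  · rwa [hs, one_smul]
  · rwa [hs, Units.neg_smul, one_smul, polyOrd_neg]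

theorem pderiv_aeval_eq_sum {σ τ : Type} [Fintype σ] (F : σ → MvPolynomial τ k)
    (G : MvPolynomial σ k) (j : τ) :
    pderiv j (aeval F G) = ∑ i, aeval F (pderiv i G) * pderiv j (F i) := by
  classical
  induction G using MvPolynomial.induction_on with
  | C a => simp
  | add A B hA hB =>
    rw [map_add, map_add, hA, hB]
    simp only [map_add, add_mul, Finset.sum_add_distrib]
  | mul_X A i hA =>
    simp only [map_mul, aeval_X, pderiv_mul, hA, map_add, pderiv_X, add_mul,
      Finset.sum_add_distrib, Finset.sum_mul]
    congr 1
    · exact Finset.sum_congr rfl fun l _ => by ring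
    · rw [Finset.sum_eq_single i]
      · simp
      · intro l _ hl
        simp [hl]
      · simp

theorem qmk_aeval {σ : Type} (F : σ → MvPolynomial (Fin 4) k) (G : MvPolynomial σ k) :
    qmk k (aeval F G) = aeval (fun i => qmk k (F i)) G :=
  DFunLike.congr_fun (comp_aeval F (Ideal.Quotient.mkₐ k (Ideal.span {qpoly k - 1}))) G

theorem quadGrad_aeval {σ : Type} [Fintype σ] (F : σ → MvPolynomial (Fin 4) k)
    (G : MvPolynomial σ k) :
    quadGrad (aeval F G) = ∑ i, aeval (fun i => qmk k (F i)) (pderiv i G) • quadGrad (F i) := by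
  ext j
  simp only [quadGrad, pderiv_aeval_eq_sum, qmk_aeval, map_sum, map_mul, Finset.sum_apply,
    Pi.smul_apply, smul_eq_mul]

theorem quadGrad_of_qmk_eq {A B : MvPolynomial (Fin 4) k} (h : qmk k A = qmk k B) :
    ∃ s : QuadRing k, quadGrad A = quadGrad B + s • quadGrad (qpoly k) := by
  obtain ⟨S, rfl⟩ := qmk_eq_qmk.1 h
  have h0 : qmk k (qpoly k - 1) = 0 :=
    Ideal.Quotient.eq_zero_iff_mem.2 (Ideal.mem_span_singleton_self _)
  refine ⟨qmk k S, ?_⟩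
  ext j
  simp only [quadGrad, map_add, pderiv_mul, map_mul, h0, map_sub, pderiv_one, Pi.add_apply,
    Pi.smul_apply, smul_eq_mul]
  simp [mul_comm]

theorem quadGrad_X (i : Fin 4) : quadGrad (X i : MvPolynomial (Fin 4) k) = Pi.single i 1 := by
  ext j
  by_cases h : i = j
  · subst h; simp [quadGrad]
  · simp [quadGrad, Ne.symm h, pderiv_X_of_ne h]

theorem vol_quadGrad_ne_zero [NoZeroDivisors (QuadRing k)] (σ : QuadRing k ≃ₐ[k] QuadRing k)
    (F : Fin 4 → MvPolynomial (Fin 4) k) (hF : ∀ i, qmk k (F i) = σ (qmk k (X i)))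
    (h0 : qmk k (F 0) ≠ 0) :
    vol (quadGrad (qpoly k)) (quadGrad (F 0)) (quadGrad (F 1)) (quadGrad (F 2)) ≠ 0 := by
  have hσ (G : MvPolynomial (Fin 4) k) : aeval (fun i => qmk k (F i)) G = σ (qmk k G) := by
    have h1 : qmk k G = aeval (fun i => qmk k (X i)) G := by
      rw [← qmk_aeval, aeval_X_left_apply]
    rw [h1, funext hF]
    exact (DFunLike.congr_fun (comp_aeval (fun i => qmk k (X i)) σ.toAlgHom) G).symm
  choose G hG using fun i => qmk_surjective (σ.symm (qmk k (X i)))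
  have hX (i : Fin 4) : qmk k (X i) = qmk k (aeval F (G i)) := by
    rw [qmk_aeval, hσ, hG, AlgEquiv.apply_symm_apply]
  have hone : qmk k (aeval F (qpoly k)) = qmk k 1 := by
    have : qmk k (qpoly k) = qmk k 1 := qmk_eq_qmk.2 ⟨1, by ring⟩
    rw [qmk_aeval, hσ, this, map_one, map_one]
  obtain ⟨t, ht⟩ := quadGrad_of_qmk_eq hone
  rw [quadGrad_aeval] at ht
  have hrow (i : Fin 4) : ∃ c : Fin 4 → QuadRing k, ∀ j,
      qmk k (F 0) * (Pi.single i 1 : Fin 4 → QuadRing k) j = ∑ l, c l *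
        (Matrix.of ![quadGrad (qpoly k), quadGrad (F 0), quadGrad (F 1), quadGrad (F 2)]) l j := by
    obtain ⟨s, hs⟩ := quadGrad_of_qmk_eq (hX i)
    rw [quadGrad_aeval, quadGrad_X] at hs
    set c := fun l => aeval (fun i => qmk k (F i)) (pderiv l (G i))
    refine ⟨![qmk k (F 0) * s + c 3 * t, qmk k (F 0) * c 0 - c 3 * qmk k (F 3),
      qmk k (F 0) * c 1 + c 3 * qmk k (F 2), qmk k (F 0) * c 2 + c 3 * qmk k (F 1)], fun j => ?_⟩
    have h1 := congrFun hs j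
    have h2 := congrFun ht j
    simp only [Fin.sum_univ_four, Pi.add_apply, Pi.smul_apply, smul_eq_mul] at h1 h2
    have hq0 : pderiv 0 (qpoly k) = X 3 := by simp [qpoly]
    have hq1 : pderiv 1 (qpoly k) = -X 2 := by simp [qpoly]
    have hq2 : pderiv 2 (qpoly k) = -X 1 := by simp [qpoly]
    have hq3 : pderiv 3 (qpoly k) = X 0 := by simp [qpoly]
    have h3 : quadGrad (1 : MvPolynomial (Fin 4) k) j = 0 := by simp [quadGrad]
    rw [h3, hq0, hq1, hq2, hq3] at h2
    simp only [map_neg, aeval_X] at h2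
    simp only [Fin.sum_univ_four, Matrix.of_apply, Matrix.cons_val]
    linear_combination qmk k (F 0) * h1 + c 3 * h2
  choose c hc using hrow
  intro hdet
  have hmul : qmk k (F 0) • (1 : Matrix (Fin 4) (Fin 4) (QuadRing k)) = Matrix.of c *
      Matrix.of ![quadGrad (qpoly k), quadGrad (F 0), quadGrad (F 1), quadGrad (F 2)] := by
    ext i j
    rw [Matrix.mul_apply, Matrix.smul_apply, smul_eq_mul, Matrix.one_eq_pi_single]
    exact hc i j
  have hd := congrArg Matrix.det hmul
  rw [vol] at hdet
  rw [Matrix.det_mul, hdet, mul_zero, Matrix.det_smul, Matrix.det_one, mul_one] at hd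
  exact h0 (pow_eq_zero_iff (by simp) |>.1 hd)

end Gradient

section DerivativeInequality

variable {k : Type} [Field k] {α : Fin 4 → ℝ} (hα : ∀ i, α i < 0) (hq : α 0 + α 3 = α 1 + α 2)

theorem vol_smul_add {K : Type} [CommRing K] (r u v w : Fin 4 → K) (c d s : K) :
    vol r (c • u + d • v + s • r) u w = d * vol r v u w := by
  simp only [vol_eq, Pi.add_apply, Pi.smul_apply, smul_eq_mul]
  ring

theorem vol_eq_zero_of_smul {K : Type} [CommRing K] (r v w : Fin 4 → K) (s : K) :
    vol r (s • r) v w = 0 := by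
  simp only [vol_eq, Pi.smul_apply, smul_eq_mul]
  ring

theorem exists_vol_single_ne_zero {K : Type} [CommRing K] {r u v w : Fin 4 → K}
    (h : vol r u v w ≠ 0) : ∃ i, vol r v u (Pi.single i 1) ≠ 0 := by
  by_contra! h0
  apply h
  have : vol r u v w = -∑ i, w i * vol r v u (Pi.single i 1) := by
    simp only [vol_eq, Fin.sum_univ_four, Pi.single_apply]
    simp
    ring
  rw [this]
  simp [h0]

include hα hq

theorem noZeroDivisors_quadRing : NoZeroDivisors (QuadRing k) where
  eq_zero_or_eq_zero_of_mul_eq_zero {f g} h := by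
    have h1 := nuSup_mul hα hq (0 : Fin 4 → k) f g
    rw [h, nuSup_zero hα, eq_comm, WithTop.add_eq_top] at h1
    simpa only [nuSup_eq_top hα hq] using h1

theorem exists_le_polyOrd (p : Fin 4 → k) {f : QuadRing k} {c : ℝ}
    (h : (c : WithTop ℝ) ≤ nuSup k p α f) : ∃ A, qmk k A = f ∧ (c : WithTop ℝ) ≤ polyOrd α A := by
  by_cases hf : f = 0
  · exact ⟨0, by rw [hf, map_zero], by rw [polyOrd_eq_top.2 rfl]; exact le_top⟩
  · obtain ⟨R, d, h1, h2, -, h4⟩ := exists_nuSup_eq hα hq p hf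
    exact ⟨R, h1, by rwa [h2, ← h4]⟩

theorem le_nuSup_vol (p : Fin 4 → k) {A B : MvPolynomial (Fin 4) k} {c d : ℝ} (i : Fin 4)
    (hA : (c : WithTop ℝ) ≤ polyOrd α A) (hB : (d : WithTop ℝ) ≤ polyOrd α B) :
    ((c + d + (α i - (α 0 + α 3)) : ℝ) : WithTop ℝ) ≤
      nuSup k p α (vol (quadGrad (qpoly k)) (quadGrad A) (quadGrad B) (Pi.single i 1)) := by
  set M : Matrix (Fin 4) (Fin 4) (MvPolynomial (Fin 4) k) :=
    Matrix.of fun l j => pderiv j ((![qpoly k, A, B, X i] : Fin 4 → MvPolynomial (Fin 4) k) l)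
  have h1 : vol (quadGrad (qpoly k)) (quadGrad A) (quadGrad B) (Pi.single i 1) = qmk k M.det := by
    rw [RingHom.map_det, vol, ← quadGrad_X]
    congr 1
    ext l j
    fin_cases l <;> rfl
  have hqo : ((α 0 + α 3 : ℝ) : WithTop ℝ) ≤ polyOrd α (qpoly k) := by
    rw [qpoly, sub_eq_add_neg]
    refine le_polyOrd_add (le_polyOrd_mul (polyOrd_X _ _).ge (polyOrd_X _ _).ge) ?_
    rw [polyOrd_neg, hq]
    exact le_polyOrd_mul (polyOrd_X _ _).ge (polyOrd_X _ _).ge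
  have h2 : ((∑ l, (![α 0 + α 3, c, d, α i] : Fin 4 → ℝ) l - ∑ l, α l : ℝ) : WithTop ℝ) ≤
      polyOrd α M.det := by
    refine le_polyOrd_det fun l j => le_polyOrd_pderiv j ?_
    fin_cases l
    · exact hqo
    · exact hA
    · exact hB
    · exact (polyOrd_X _ _).ge
  rw [h1]
  refine le_trans ?_ (h2.trans (polyOrd_le_nuSup hα hq p _))
  rw [WithTop.coe_le_coe]
  simp only [Fin.sum_univ_four, Matrix.cons_val]
  linarith

theorem nuSup_component_neg (p : Fin 4 → k) (σ : QuadRing k ≃ₐ[k] QuadRing k) {a : ℝ}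
    (ha : nuSup k p α (σ (qmk k (X 0))) = a) : a < 0 := by
  have := noZeroDivisors_quadRing (k := k) hα hq
  have hne : σ (qmk k (X 0)) ≠ 0 := fun h => by simp [h, nuSup_zero hα] at ha
  refine lt_of_le_of_ne ?_ ?_
  · have := nuSup_le_zero hα hq p hne
    rwa [ha, WithTop.coe_le_coe] at this
  rintro rfl
  obtain ⟨c, hc⟩ := eq_algebraMap_of_nuSup_eq_zero hα hq p ha
  choose F hF using fun i => qmk_surjective (σ (qmk k (X i)))
  have h0 : qmk k (F 0) = qmk k (C c) := by rw [hF, hc]; rfl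
  obtain ⟨s, hs⟩ := quadGrad_of_qmk_eq h0
  refine vol_quadGrad_ne_zero σ F hF (by rwa [hF]) ?_
  have : quadGrad (C c : MvPolynomial (Fin 4) k) = 0 := by
    ext j
    simp [quadGrad]
  rw [hs, this, zero_add, vol_eq_zero_of_smul]

theorem exists_le_nuSup_pderiv (p : Fin 4 → k) (σ : QuadRing k ≃ₐ[k] QuadRing k) {a : ℝ}
    (ha : nuSup k p α (σ (qmk k (X 0))) = a) :
    ∃ e : ℝ, 0 < e ∧ ∀ (R : MvPolynomial (Fin 2) k) (c : ℝ),
      (c : WithTop ℝ) ≤ nuSup k p α (aeval ![σ (qmk k (X 0)), σ (qmk k (X 1))] R) →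
      ((c + a + e : ℝ) : WithTop ℝ) ≤
        nuSup k p α (aeval ![σ (qmk k (X 0)), σ (qmk k (X 1))] (pderiv 1 R)) := by
  have := noZeroDivisors_quadRing (k := k) hα hq
  have hne : σ (qmk k (X 0)) ≠ 0 := fun h => by simp [h, nuSup_zero hα] at ha
  choose F' hF' using fun i => qmk_surjective (σ (qmk k (X i)))
  obtain ⟨F0, hF0, hF0a⟩ := exists_le_polyOrd hα hq p ha.ge
  set F := Function.update F' 0 F0 with hFdef
  have hF (i) : qmk k (F i) = σ (qmk k (X i)) := by
    by_cases hi : i = 0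
    · subst hi; simpa [F] using hF0
    · simpa [F, hi] using hF' i
  have hFa : (a : WithTop ℝ) ≤ polyOrd α (F 0) := by simpa [F] using hF0a
  obtain ⟨i, hi⟩ := exists_vol_single_ne_zero (vol_quadGrad_ne_zero σ F hF (by rwa [hF]))
  refine ⟨α i - (α 0 + α 3), ?_, fun R c hc => ?_⟩
  · have h0 := hα 0
    have h1 := hα 1
    have h2 := hα 2
    have h3 := hα 3
    fin_cases i <;> simp <;> linarith
  obtain ⟨A, hA, hAc⟩ := exists_le_polyOrd hα hq p hc
  have hvec : (fun j => qmk k ((![F 0, F 1] : Fin 2 → MvPolynomial (Fin 4) k) j)) =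
      ![σ (qmk k (X 0)), σ (qmk k (X 1))] := by
    ext j
    fin_cases j
    · exact hF 0
    · exact hF 1
  have hAR : qmk k A = qmk k (aeval ![F 0, F 1] R) := by rw [hA, qmk_aeval, hvec]
  obtain ⟨s, hs⟩ := quadGrad_of_qmk_eq hAR
  rw [quadGrad_aeval, hvec, Fin.sum_univ_two] at hs
  have hv := le_nuSup_vol hα hq p i hAc hFa
  rw [hs] at hv
  simp only [Matrix.cons_val_zero, Matrix.cons_val_one] at hv
  rw [vol_smul_add, nuSup_mul hα hq] at hv
  refine hv.trans ?_
  calc _ ≤ nuSup k p α (aeval ![σ (qmk k (X 0)), σ (qmk k (X 1))] (pderiv 1 R)) +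
      ((0 : ℝ) : WithTop ℝ) := by gcongr; exact nuSup_le_zero hα hq p hi
    _ = _ := by simp

end DerivativeInequality

section Binomial

variable {k : Type} [Field k]

/-- The binomial form `∑ m ≤ n, pₘ X^(s₁ m) Y^(s₂ (n - m))` attached to a univariate polynomial. -/
def binForm (s1 s2 n : ℕ) (p : Polynomial k) : MvPolynomial (Fin 2) k :=
  aeval ![X 0 ^ s1, X 1 ^ s2] (p.homogenize n)

theorem binForm_mul (s1 s2 : ℕ) {m n : ℕ} {p q : Polynomial k} (hp : p.natDegree ≤ m)
    (hq : q.natDegree ≤ n) :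
    binForm s1 s2 (m + n) (p * q) = binForm s1 s2 m p * binForm s1 s2 n q := by
  rw [binForm, Polynomial.homogenize_mul _ _ hp hq, map_mul, binForm, binForm]

theorem binForm_C (s1 s2 n : ℕ) (c : k) :
    binForm s1 s2 n (Polynomial.C c) = C c * (X 1 ^ s2) ^ n := by
  simp only [binForm, Polynomial.homogenize_C, map_mul, map_pow, aeval_C, aeval_X,
    MvPolynomial.algebraMap_eq, Matrix.cons_val_one]
  rfl

theorem binForm_monomial (s1 s2 : ℕ) {m n : ℕ} (h : m ≤ n) (c : k) :
    binForm s1 s2 n (Polynomial.monomial m c) =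
      C c * (X 0 ^ s1) ^ m * (X 1 ^ s2) ^ (n - m) := by
  rw [← Polynomial.C_mul_X_pow_eq_monomial, binForm, Polynomial.homogenize_C_mul,
    Polynomial.homogenize_X_pow h]
  simp only [map_mul, map_pow, aeval_C, aeval_X, MvPolynomial.algebraMap_eq, mul_assoc]
  rfl

theorem binForm_X_sub_C (s1 s2 : ℕ) (c : k) :
    binForm s1 s2 1 (Polynomial.X - Polynomial.C c) = X 0 ^ s1 - C c * X 1 ^ s2 := by
  have h1 : (Polynomial.X - Polynomial.C c : Polynomial k) =
      Polynomial.monomial 1 1 + Polynomial.C (-c) := by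
    rw [← Polynomial.X, map_neg, sub_eq_add_neg]
  have h2 : binForm s1 s2 1 (Polynomial.X - Polynomial.C c : Polynomial k) =
      binForm s1 s2 1 (Polynomial.monomial 1 1) + binForm s1 s2 1 (Polynomial.C (-c)) := by
    rw [h1, binForm, Polynomial.homogenize_add, map_add, binForm, binForm]
  rw [h2, binForm_monomial _ _ le_rfl, binForm_C]
  simp [sub_eq_add_neg]

theorem binForm_sum (s1 s2 n : ℕ) {ι : Type*} (s : Finset ι) (p : ι → Polynomial k) :
    binForm s1 s2 n (∑ i ∈ s, p i) = ∑ i ∈ s, binForm s1 s2 n (p i) := by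
  rw [binForm, Polynomial.homogenize_finsetSum, map_sum]
  rfl

theorem binForm_pow_mul (s1 s2 N : ℕ) {n : ℕ} {q : Polynomial k} (c : k) (hq : q.natDegree ≤ n) :
    binForm s1 s2 (N + n) ((Polynomial.X - Polynomial.C c) ^ N * q) =
      (X 0 ^ s1 - C c * X 1 ^ s2) ^ N * binForm s1 s2 n q := by
  induction N with
  | zero => simp
  | succ N ih =>
    rw [pow_succ', mul_assoc, show N + 1 + n = 1 + (N + n) by ring, binForm_mul _ _ (by simp),
      ih, binForm_X_sub_C, pow_succ', mul_assoc]
    refine Polynomial.natDegree_mul_le.trans (add_le_add ?_ hq)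
    simp

/-- The exponents of the monomials of fixed weight, for weights `(w₀, w₁)` with `s₁ w₀ = s₂ w₁`,
form an arithmetic progression of step `(s₁, -s₂)`. -/
theorem exists_exponents {s1 s2 : ℕ} (hs1 : 0 < s1) (hs2 : 0 < s2) (hcop : Nat.Coprime s1 s2)
    {w : Fin 2 → ℝ} (hw0 : w 0 < 0) (hw : (s1 : ℝ) * w 0 = s2 * w 1) (i0 j0 : ℕ) :
    ∃ i j n : ℕ, w 0 * i + w 1 * j + n * (s1 * w 0) = w 0 * i0 + w 1 * j0 ∧
      ∀ i' j' : ℕ, w 0 * i' + w 1 * j' = w 0 * i0 + w 1 * j0 →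
        ∃ m ≤ n, i' = i + s1 * m ∧ j' = j + s2 * (n - m) := by
  have hs2' : (s2 : ℝ) ≠ 0 := by positivity
  have key (i' j' : ℕ) (h : w 0 * i' + w 1 * j' = w 0 * i0 + w 1 * j0) :
      i' * s2 + j' * s1 = i0 * s2 + j0 * s1 := by
    have : w 0 * ((i' * s2 + j' * s1 : ℕ) : ℝ) = w 0 * ((i0 * s2 + j0 * s1 : ℕ) : ℝ) := by
      push_cast
      linear_combination s2 * h + (j' - j0 : ℝ) * hw
    exact_mod_cast mul_left_cancel₀ hw0.ne this
  set J := j0 + s2 * (i0 / s1) with hJ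
  have hi0 := Nat.mod_add_div i0 s1
  have hJ0 := Nat.mod_add_div J s2
  have hi0R : ((i0 % s1 : ℕ) : ℝ) + s1 * ((i0 / s1 : ℕ) : ℝ) = i0 := by exact_mod_cast hi0
  have hJ0R : ((J % s2 : ℕ) : ℝ) + s2 * ((J / s2 : ℕ) : ℝ) = j0 + s2 * ((i0 / s1 : ℕ) : ℝ) := by
    exact_mod_cast hJ0
  refine ⟨i0 % s1, J % s2, J / s2, ?_, fun i' j' h => ?_⟩
  · linear_combination w 0 * hi0R + w 1 * hJ0R +
      (((J / s2 : ℕ) : ℝ) - ((i0 / s1 : ℕ) : ℝ)) * hw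
  have h1 := key i' j' h
  have hmod : i' % s1 = i0 % s1 := by
    have : i' * s2 ≡ i0 * s2 [MOD s1] := by
      have h2 := congrArg (· % s1) h1
      simpa [Nat.ModEq] using h2
    exact Nat.ModEq.cancel_right_of_coprime hcop this
  have hi' := Nat.mod_add_div i' s1
  rw [hmod] at hi'
  have hj' : j' + s2 * (i' / s1) = J := by
    have : s1 * (j' + s2 * (i' / s1)) = s1 * J := by
      rw [hJ]
      zify at *
      linear_combination h1 + s2 * hi' - s2 * hi0
    exact Nat.eq_of_mul_eq_mul_left hs1 this
  have hle : i' / s1 ≤ J / s2 := by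
    rw [Nat.le_div_iff_mul_le hs2]
    linarith
  refine ⟨i' / s1, hle, hi'.symm, ?_⟩
  obtain ⟨d, hd⟩ := Nat.exists_eq_add_of_le hle
  rw [hd, Nat.add_sub_cancel_left]
  rw [hd] at hJ0
  linarith

theorem exists_eq_binForm {s1 s2 : ℕ} (hs1 : 0 < s1) (hs2 : 0 < s2) (hcop : Nat.Coprime s1 s2)
    {w : Fin 2 → ℝ} (hw0 : w 0 < 0) (hw : (s1 : ℝ) * w 0 = s2 * w 1)
    {P : MvPolynomial (Fin 2) k} {c : ℝ} (hP0 : P ≠ 0)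
    (hP : ∀ I, coeff I P ≠ 0 → ∑ l, w l * (I l : ℝ) = c) :
    ∃ (i j n : ℕ) (p : Polynomial k), w 0 * i + w 1 * j + n * (s1 * w 0) = c ∧ p ≠ 0 ∧
      p.natDegree ≤ n ∧ P = X 0 ^ i * X 1 ^ j * binForm s1 s2 n p := by
  obtain ⟨I0, hI0⟩ := support_nonempty.2 hP0
  simp only [Fin.sum_univ_two] at hP
  obtain ⟨i, j, n, h1, h2⟩ := exists_exponents hs1 hs2 hcop hw0 hw (I0 0) (I0 1)
  rw [hP I0 (mem_support_iff.1 hI0)] at h1 h2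
  have h3 (I : Fin 2 →₀ ℕ) : ∃ m ≤ n, coeff I P ≠ 0 → I 0 = i + s1 * m ∧ I 1 = j + s2 * (n - m) := by
    by_cases hI : coeff I P = 0
    · exact ⟨0, zero_le, fun h => absurd hI h⟩
    · obtain ⟨m, hm, h⟩ := h2 (I 0) (I 1) (hP I hI)
      exact ⟨m, hm, fun _ => h⟩
  choose m hm hmI using h3
  have heq : P = X 0 ^ i * X 1 ^ j *
      binForm s1 s2 n (∑ I ∈ P.support, Polynomial.monomial (m I) (coeff I P)) := by
    rw [binForm_sum, Finset.mul_sum]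
    conv_lhs => rw [P.as_sum]
    refine Finset.sum_congr rfl fun I hI => ?_
    obtain ⟨h4, h5⟩ := hmI I (mem_support_iff.1 hI)
    rw [binForm_monomial _ _ (hm I), monomial_eq, Finsupp.prod_fintype _ _ (by simp),
      Fin.prod_univ_two, h4, h5]
    ring
  refine ⟨i, j, n, _, h1, fun h0 => hP0 ?_, ?_, heq⟩
  · rw [heq, h0]
    simp [binForm]
  · exact Polynomial.natDegree_sum_le_of_forall_le _ _ fun I _ =>
      (Polynomial.natDegree_monomial_le _).trans (hm I)

theorem le_polyOrd_pow {w : Fin 2 → ℝ} {A : MvPolynomial (Fin 2) k} {c : ℝ}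
    (h : (c : WithTop ℝ) ≤ polyOrd w A) (n : ℕ) :
    ((n * c : ℝ) : WithTop ℝ) ≤ polyOrd w (A ^ n) := by
  induction n with
  | zero => simpa using le_polyOrd_C w (1 : k)
  | succ n ih =>
    rw [pow_succ]
    convert le_polyOrd_mul ih h using 2
    push_cast
    ring

theorem le_polyOrd_binForm {s1 s2 : ℕ} {w : Fin 2 → ℝ} (hw : (s1 : ℝ) * w 0 = s2 * w 1)
    {n : ℕ} {p : Polynomial k} (hp : p.natDegree ≤ n) :
    ((n * (s1 * w 0) : ℝ) : WithTop ℝ) ≤ polyOrd w (binForm s1 s2 n p) := by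
  rw [p.as_sum_range, binForm_sum]
  refine le_polyOrd_sum fun m hm => ?_
  have hmn : m ≤ n := (Finset.mem_range_succ_iff.1 hm).trans hp
  rw [binForm_monomial _ _ hmn]
  have h0 := le_polyOrd_pow (le_polyOrd_pow (polyOrd_X (k := k) w 0).ge s1) m
  have h1 := le_polyOrd_pow (le_polyOrd_pow (polyOrd_X (k := k) w 1).ge s2) (n - m)
  convert le_polyOrd_mul (le_polyOrd_mul (le_polyOrd_C w (p.coeff m)) h0) h1 using 2
  rw [Nat.cast_sub hmn]
  linear_combination (n - m : ℝ) * hw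

end Binomial

theorem le_coe_of_forall_coe_le {x : WithTop ℝ} {B : ℝ} (h : ∀ c : ℝ, (c : WithTop ℝ) ≤ x → c ≤ B) :
    x ≤ B := by
  induction x with
  | top => exact absurd (h (B + 1) le_top) (by simp)
  | coe r => exact WithTop.coe_le_coe.2 (h r le_rfl)

section Valuation

variable {k : Type} [Field k] {K : Type} [CommRing K] [Algebra k K] {ν : K → WithTop ℝ}
  (hν : IsValuation k K ν)

include hν

theorem IsValuation.map_neg (g : K) : ν (-g) = ν g := by
  obtain ⟨-, h2, h3, -⟩ := hν
  have h := h3 (algebraMap k K (-1)) g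
  rwa [h2 _ (by simp), zero_add, _root_.map_neg, map_one, neg_one_mul] at h

theorem IsValuation.lt_map_add {g h : K} {c : WithTop ℝ} (hg : c < ν g) (hh : c < ν h) :
    c < ν (g + h) :=
  (lt_min hg hh).trans_le (hν.2.2.2 g h)

theorem IsValuation.map_add_eq {g h : K} (hh : ν g < ν h) : ν (g + h) = ν g := by
  refine le_antisymm ?_ (by simpa [hh.le] using hν.2.2.2 g h)
  by_contra! h1
  have h2 := hν.lt_map_add h1 (hh.trans_eq (hν.map_neg h).symm)
  rw [add_neg_cancel_right] at h2
  exact h2.false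

theorem IsValuation.map_pow {g : K} {c : ℝ} (hg : ν g = c) (n : ℕ) :
    ν (g ^ n) = ((n * c : ℝ) : WithTop ℝ) := by
  induction n with
  | zero => simpa using hν.2.1 1 one_ne_zero
  | succ n ih =>
    rw [pow_succ, hν.2.2.1, ih, hg, ← WithTop.coe_add]
    rw [WithTop.coe_inj]
    push_cast
    ring

theorem IsValuation.map_algebraMap_mul {c : k} (hc : c ≠ 0) (g : K) :
    ν (algebraMap k K c * g) = ν g := by
  rw [hν.2.2.1, hν.2.1 c hc, zero_add]

theorem IsValuation.le_map_sum {ι : Type*} {s : Finset ι} {A : ι → K} {c : WithTop ℝ}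
    (h : ∀ i ∈ s, c ≤ ν (A i)) : c ≤ ν (∑ i ∈ s, A i) :=
  Finset.sum_induction _ (fun B => c ≤ ν B)
    (fun A B hA hB => (le_min hA hB).trans (hν.2.2.2 A B)) (by simp [(hν.1 0).2 rfl]) h

variable {f : Fin 2 → K} {w : Fin 2 → ℝ} (hf : ∀ i, ν (f i) = w i)

include hf

theorem polyOrd_le_map_aeval (R : MvPolynomial (Fin 2) k) : polyOrd w R ≤ ν (aeval f R) := by
  rw [aeval_def, eval₂_eq']
  refine hν.le_map_sum fun I hI => ?_
  have hI' := mem_support_iff.1 hI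
  refine (polyOrd_le hI').trans_eq ?_
  rw [hν.map_algebraMap_mul hI', Fin.prod_univ_two, hν.2.2.1, hν.map_pow (hf 0),
    hν.map_pow (hf 1), ← WithTop.coe_add, Fin.sum_univ_two]
  ring_nf

variable {s1 s2 : ℕ} (hw : (s1 : ℝ) * w 0 = s2 * w 1)

include hw

theorem le_map_binomial (c : k) :
    ((s1 * w 0 : ℝ) : WithTop ℝ) ≤ ν (aeval f (X 0 ^ s1 - C c * X 1 ^ s2)) := by
  refine le_trans ?_ (polyOrd_le_map_aeval hν hf _)
  rw [← binForm_X_sub_C]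
  simpa using le_polyOrd_binForm hw (n := 1) (p := Polynomial.X - Polynomial.C c) (by simp)

theorem eq_of_lt_map_binomial {c d : k}
    (hc : ((s1 * w 0 : ℝ) : WithTop ℝ) < ν (aeval f (X 0 ^ s1 - C c * X 1 ^ s2)))
    (hd : ((s1 * w 0 : ℝ) : WithTop ℝ) < ν (aeval f (X 0 ^ s1 - C d * X 1 ^ s2))) : c = d := by
  by_contra hne
  have h1 := hν.lt_map_add hc (hd.trans_eq (hν.map_neg _).symm)
  have h2 : aeval f (X 0 ^ s1 - C c * X 1 ^ s2) + -aeval f (X 0 ^ s1 - C d * X 1 ^ s2) =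
      algebraMap k K (d - c) * f 1 ^ s2 := by
    simp only [map_sub, map_mul, _root_.map_pow, aeval_X, aeval_C]
    ring
  rw [h2, hν.map_algebraMap_mul (sub_ne_zero.2 (Ne.symm hne)), hν.map_pow (hf 1), ← hw] at h1
  exact h1.false

theorem map_binForm [IsAlgClosed k] {n : ℕ} {p : Polynomial k} (hp0 : p ≠ 0) (hp : p.natDegree ≤ n)
    (hroot : ∀ c, p.IsRoot c →
      ν (aeval f (X 0 ^ s1 - C c * X 1 ^ s2)) = ((s1 * w 0 : ℝ) : WithTop ℝ)) :
    ν (aeval f (binForm s1 s2 n p)) = ((n * (s1 * w 0) : ℝ) : WithTop ℝ) := by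
  induction n generalizing p with
  | zero =>
    rw [Polynomial.eq_C_of_natDegree_le_zero hp, binForm_C, pow_zero, mul_one, aeval_C, hν.2.1]
    · simp
    · intro h
      rw [Polynomial.eq_C_of_natDegree_le_zero hp, h, map_zero] at hp0
      exact hp0 rfl
  | succ n ih =>
    rcases eq_or_ne p.natDegree 0 with h0 | h0
    · have hp1 := Polynomial.eq_C_of_natDegree_eq_zero h0
      have hc : p.coeff 0 ≠ 0 := fun h => hp0 (by rw [hp1, h, map_zero])
      rw [hp1, binForm_C, map_mul, aeval_C, hν.map_algebraMap_mul hc, ← pow_mul,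
        _root_.map_pow, aeval_X, hν.map_pow (hf 1), hw]
      rw [WithTop.coe_inj]
      push_cast
      ring
    · obtain ⟨c, hc⟩ := IsAlgClosed.exists_root p
        (fun h => h0 (Polynomial.natDegree_eq_of_degree_eq_some h))
      obtain ⟨q, rfl⟩ := Polynomial.dvd_iff_isRoot.2 hc
      have hq0 : q ≠ 0 := right_ne_zero_of_mul hp0
      have hq : q.natDegree ≤ n := by
        rw [Polynomial.natDegree_mul (Polynomial.X_sub_C_ne_zero c) hq0,
          Polynomial.natDegree_X_sub_C] at hp
        omega
      rw [add_comm n 1, binForm_mul _ _ (by simp) hq, map_mul, hν.2.2.1, binForm_X_sub_C,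
        hroot c hc, ih hq0 hq fun d hd => hroot d ?_, ← WithTop.coe_add]
      · rw [WithTop.coe_inj]
        push_cast
        ring
      · rw [Polynomial.IsRoot, Polynomial.eval_mul, hd, mul_zero]

theorem map_monomial_mul_binForm [IsAlgClosed k] (i j : ℕ) {n : ℕ} {p : Polynomial k}
    (hp0 : p ≠ 0) (hp : p.natDegree ≤ n) (hroot : ∀ c, p.IsRoot c →
      ν (aeval f (X 0 ^ s1 - C c * X 1 ^ s2)) = ((s1 * w 0 : ℝ) : WithTop ℝ)) :
    ν (aeval f (X 0 ^ i * X 1 ^ j * binForm s1 s2 n p)) =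
      ((w 0 * i + w 1 * j + n * (s1 * w 0) : ℝ) : WithTop ℝ) := by
  rw [map_mul, map_mul, hν.2.2.1, hν.2.2.1, map_binForm hν hf hw hp0 hp hroot, _root_.map_pow,
    _root_.map_pow, aeval_X, aeval_X, hν.map_pow (hf 0), hν.map_pow (hf 1), ← WithTop.coe_add,
    ← WithTop.coe_add, mul_comm (i : ℝ), mul_comm (j : ℝ)]

omit hν hf in
theorem le_polyOrd_monomial_mul_binForm (i j : ℕ) {n : ℕ} {p : Polynomial k}
    (hp : p.natDegree ≤ n) :
    ((w 0 * i + w 1 * j + n * (s1 * w 0) : ℝ) : WithTop ℝ) ≤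
      polyOrd w (X 0 ^ i * X 1 ^ j * binForm s1 s2 n p) := by
  rw [mul_comm (w 0), mul_comm (w 1)]
  exact le_polyOrd_mul (le_polyOrd_mul (le_polyOrd_pow (polyOrd_X w 0).ge i)
    (le_polyOrd_pow (polyOrd_X w 1).ge j)) (le_polyOrd_binForm hw hp)

theorem map_aeval_le [CharZero k] {e : ℝ} (hs2 : 0 < s2)
    (hD : ∀ (R : MvPolynomial (Fin 2) k) (c : ℝ), (c : WithTop ℝ) ≤ ν (aeval f R) →
      ((c + w 0 + e : ℝ) : WithTop ℝ) ≤ ν (aeval f (pderiv 1 R)))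
    {c : k} (hc : c ≠ 0)
    (hg : ((s1 * w 0 : ℝ) : WithTop ℝ) < ν (aeval f (X 0 ^ s1 - C c * X 1 ^ s2)))
    (N : ℕ) {h : ℝ} {H L : MvPolynomial (Fin 2) k} (hH : (h : WithTop ℝ) ≤ polyOrd w H)
    (hHf : ν (aeval f H) = h) (hL : ((h + N * (s1 * w 0) : ℝ) : WithTop ℝ) < polyOrd w L) :
    ν (aeval f ((X 0 ^ s1 - C c * X 1 ^ s2) ^ N * H + L)) ≤
      ((h + N * (s1 * w 0 - w 0 - w 1 - e) : ℝ) : WithTop ℝ) := by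
  set G : MvPolynomial (Fin 2) k := X 0 ^ s1 - C c * X 1 ^ s2 with hG
  have hGo : ((s1 * w 0 : ℝ) : WithTop ℝ) ≤ polyOrd w G := by
    rw [hG, ← binForm_X_sub_C]
    simpa using le_polyOrd_binForm hw (n := 1) (p := Polynomial.X - Polynomial.C c) (by simp)
  induction N generalizing h H L with
  | zero =>
    simp only [Nat.cast_zero, zero_mul, add_zero] at hL ⊢
    rw [pow_zero, one_mul, map_add, hν.map_add_eq, hHf]
    rw [hHf]
    exact hL.trans_le (polyOrd_le_map_aeval hν hf L)
  | succ N ih =>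
    set d : k := -((N + 1) * (c * s2)) with hd
    have hd0 : d ≠ 0 := by
      rw [hd, neg_ne_zero]
      exact mul_ne_zero (by exact_mod_cast N.succ_ne_zero)
        (mul_ne_zero hc (by exact_mod_cast hs2.ne'))
    have hder : pderiv 1 (G ^ (N + 1) * H + L) =
        G ^ N * (C d * X 1 ^ (s2 - 1) * H + G * pderiv 1 H) + pderiv 1 L := by
      have : pderiv 1 G = -(C c * ((s2 : MvPolynomial (Fin 2) k) * X 1 ^ (s2 - 1))) := by
        simp [hG]
      rw [map_add, pderiv_mul, pderiv_pow, this, hd]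
      simp only [map_neg, map_mul, map_add, map_natCast, map_one, Nat.add_sub_cancel]
      push_cast
      ring
    have hcast : ((s2 - 1 : ℕ) : ℝ) = s2 - 1 := by rw [Nat.cast_sub hs2]; simp
    have h1o : ((h + (s2 - 1) * w 1 : ℝ) : WithTop ℝ) ≤
        polyOrd w (C d * X 1 ^ (s2 - 1) * H + G * pderiv 1 H) := by
      refine le_polyOrd_add ?_ ?_
      · convert le_polyOrd_mul (le_polyOrd_mul (le_polyOrd_C w d)
          (le_polyOrd_pow (polyOrd_X w 1).ge (s2 - 1))) hH using 2
        rw [hcast]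
        ring
      · convert le_polyOrd_mul hGo (le_polyOrd_pderiv 1 hH) using 2
        linear_combination -hw
    have h1f : ν (aeval f (C d * X 1 ^ (s2 - 1) * H)) = ((h + (s2 - 1) * w 1 : ℝ) : WithTop ℝ) := by
      rw [mul_assoc, map_mul, aeval_C, hν.map_algebraMap_mul hd0, map_mul, hν.2.2.1, hHf,
        _root_.map_pow, aeval_X, hν.map_pow (hf 1), hcast, ← WithTop.coe_add]
      ring_nf
    have h2f : ((h + (s2 - 1) * w 1 : ℝ) : WithTop ℝ) < ν (aeval f (G * pderiv 1 H)) := by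
      rw [map_mul, hν.2.2.1]
      have h3 := (le_polyOrd_pderiv 1 hH).trans (polyOrd_le_map_aeval hν hf (pderiv 1 H))
      calc ((h + (s2 - 1) * w 1 : ℝ) : WithTop ℝ)
          = ((s1 * w 0 : ℝ) : WithTop ℝ) + ((h - w 1 : ℝ) : WithTop ℝ) := by
            rw [← WithTop.coe_add, WithTop.coe_inj]
            linear_combination -hw
        _ < ν (aeval f G) + ((h - w 1 : ℝ) : WithTop ℝ) :=
            WithTop.add_lt_add_right WithTop.coe_ne_top hg
        _ ≤ _ := by gcongr
    have hsum : ν (aeval f (C d * X 1 ^ (s2 - 1) * H + G * pderiv 1 H)) =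
        ((h + (s2 - 1) * w 1 : ℝ) : WithTop ℝ) := by
      rw [map_add, hν.map_add_eq (h1f.trans_lt h2f), h1f]
    have hL' : ((h + (s2 - 1) * w 1 + N * (s1 * w 0) : ℝ) : WithTop ℝ) <
        polyOrd w (pderiv 1 L) := by
      convert lt_polyOrd_pderiv 1 hL using 2
      push_cast
      linear_combination -hw
    have hih := ih h1o hsum hL'
    rw [← hder] at hih
    refine le_coe_of_forall_coe_le fun r hr => ?_
    have h4 := (hD _ r hr).trans hih
    rw [WithTop.coe_le_coe] at h4
    push_cast
    linarith

theorem map_aeval_eq_or_lt [IsAlgClosed k] [CharZero k] {e : ℝ} (he : 0 < e)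
    (hs1 : 2 ≤ s1) (hs2 : 2 ≤ s2) (hcop : Nat.Coprime s1 s2) (hw0 : w 0 < 0) (hw1 : w 1 < 0)
    (hD : ∀ (R : MvPolynomial (Fin 2) k) (c : ℝ), (c : WithTop ℝ) ≤ ν (aeval f R) →
      ((c + w 0 + e : ℝ) : WithTop ℝ) ≤ ν (aeval f (pderiv 1 R)))
    {R : MvPolynomial (Fin 2) k} (hR : R ≠ 0) :
    ν (aeval f R) = polyOrd w R ∨ ν (aeval f R) < ((s1 * w 0 - w 0 - w 1 : ℝ) : WithTop ℝ) := by
  classical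
  obtain ⟨I0, hI0, hc⟩ := exists_polyOrd_eq (w := w) hR
  set c := ∑ i, w i * (I0 i : ℝ) with hcdef
  set P := weightedHomogeneousComponent w c R with hPdef
  have hP0 : P ≠ 0 := fun h => hI0 (by
    have := coeff_component w c R I0
    rwa [if_pos hcdef.symm, ← hPdef, h, coeff_zero, eq_comm] at this)
  have hPc (I : Fin 2 →₀ ℕ) (hI : coeff I P ≠ 0) : ∑ l, w l * (I l : ℝ) = c := by
    by_contra h
    exact hI (by rw [hPdef, coeff_component, if_neg h])
  have hL : (c : WithTop ℝ) < polyOrd w (R - P) := lt_polyOrd_sub_component hc.ge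
  have hRP : R = P + (R - P) := by ring
  obtain ⟨i, j, n, p, hijn, hp0, hp, hP⟩ := exists_eq_binForm (by omega) (by omega) hcop hw0 hw hP0 hPc
  by_cases hbad : ∃ d : k,
      ((s1 * w 0 : ℝ) : WithTop ℝ) < ν (aeval f (X 0 ^ s1 - C d * X 1 ^ s2))
  swap
  · left
    push Not at hbad
    have h1 := map_monomial_mul_binForm hν hf hw i j hp0 hp
      fun d _ => (hbad d).antisymm (le_map_binomial hν hf hw d)
    rw [← hP, hijn] at h1
    rw [hc, hRP, map_add, hν.map_add_eq, h1]
    rw [h1]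
    exact hL.trans_le (polyOrd_le_map_aeval hν hf _)
  obtain ⟨d, hd⟩ := hbad
  have hd0 : d ≠ 0 := by
    rintro rfl
    rw [C_0, zero_mul, sub_zero, _root_.map_pow, aeval_X, hν.map_pow (hf 0)] at hd
    exact hd.false
  obtain ⟨q, hq, hdq⟩ := Polynomial.exists_eq_pow_rootMultiplicity_mul_and_not_dvd p hp0 d
  set N := p.rootMultiplicity d
  have hq0 : q ≠ 0 := by rintro rfl; exact hdq (dvd_zero _)
  have hdeg : p.natDegree = N + q.natDegree := by
    conv_lhs => rw [hq]
    rw [Polynomial.natDegree_mul (pow_ne_zero _ (Polynomial.X_sub_C_ne_zero d)) hq0,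
      Polynomial.natDegree_pow, Polynomial.natDegree_X_sub_C, mul_one]
  obtain ⟨m, rfl⟩ : ∃ m, n = N + m := ⟨n - N, by omega⟩
  have hqm : q.natDegree ≤ m := by omega
  rw [hq, binForm_pow_mul _ _ _ _ hqm, mul_left_comm] at hP
  have hHf := map_monomial_mul_binForm hν hf hw i j hq0 hqm fun d' hd' => by
    refine le_antisymm ?_ (le_map_binomial hν hf hw d')
    by_contra! h
    rw [← eq_of_lt_map_binomial hν hf hw hd h] at hd'
    exact hdq (Polynomial.dvd_iff_isRoot.2 hd')
  have hHo := le_polyOrd_monomial_mul_binForm hw i j hqm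
  set H : MvPolynomial (Fin 2) k := X 0 ^ i * X 1 ^ j * binForm s1 s2 m q
  set h : ℝ := w 0 * i + w 1 * j + m * (s1 * w 0) with hh
  have hhc : h + N * (s1 * w 0) = c := by
    rw [← hijn, hh]
    push_cast
    ring
  rcases Nat.eq_zero_or_pos N with hN | hN
  · left
    rw [hN, pow_zero, one_mul] at hP
    rw [hN, Nat.cast_zero, zero_mul, add_zero] at hhc
    rw [← hP, hhc] at hHf
    rw [hc, hRP, map_add, hν.map_add_eq, hHf]
    rw [hHf]
    exact hL.trans_le (polyOrd_le_map_aeval hν hf _)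
  · right
    rw [← hhc] at hL
    have hle := map_aeval_le hν hf hw (by omega) hD hd0 hd N hHo hHf hL
    rw [← hP, ← hRP] at hle
    refine hle.trans_lt (WithTop.coe_lt_coe.2 ?_)
    have hs1' : (2 : ℝ) ≤ s1 := by exact_mod_cast hs1
    have hs2' : (2 : ℝ) ≤ s2 := by exact_mod_cast hs2
    have hN' : (1 : ℝ) ≤ N := by exact_mod_cast hN
    have hneg : s1 * w 0 - w 0 - w 1 ≤ 0 := by nlinarith
    have hh0 : h ≤ 0 := by
      have h1 : w 0 * i ≤ 0 := mul_nonpos_of_nonpos_of_nonneg hw0.le i.cast_nonneg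
      have h2 : w 1 * j ≤ 0 := mul_nonpos_of_nonpos_of_nonneg hw1.le j.cast_nonneg
      have h3 : m * (s1 * w 0) ≤ 0 := mul_nonpos_of_nonneg_of_nonpos m.cast_nonneg
        (mul_nonpos_of_nonneg_of_nonpos s1.cast_nonneg hw0.le)
      linarith
    nlinarith

end Valuation

/-- Theorem 4.17 (iii): let `ν ∈ 𝒱₀` and let `(f₁, f₂)` be a component
of an automorphism of `Q` which is properly resonant with respect to `ν`: there are
coprime integers `s₁, s₂ ≥ 2` with `s₁·ν(f₁) = s₂·ν(f₂)` (where `ν(f₁) = a`,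
`ν(f₂) = b`). Then for every nonzero `R ∈ k[X,Y]`, either `ν(R(f₁,f₂)) = ν₀(R)`, or
`ν(R(f₁,f₂)) > ν₀(R)` and
`ν(R(f₁,f₂)) < min((s₁ - 1 - s₁/s₂)·ν(f₁), (s₂ - 1 - s₂/s₁)·ν(f₂))`. -/
theorem val_component_properly_resonant (k : Type) [Field k] [IsAlgClosed k] [CharZero k]
    (ν : QuadRing k → WithTop ℝ) (hν : ν ∈ V0 k)
    (f1 f2 : QuadRing k) (hcomp : IsComponent k f1 f2)
    (a b : ℝ) (ha : ν f1 = (a : WithTop ℝ)) (hb : ν f2 = (b : WithTop ℝ))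
    (s1 s2 : ℕ) (hs1 : 2 ≤ s1) (hs2 : 2 ≤ s2) (hcop : Nat.Coprime s1 s2)
    (hw : (s1 : ℝ) * a = (s2 : ℝ) * b) :
    ∀ R : MvPolynomial (Fin 2) k, R ≠ 0 →
      ν (MvPolynomial.aeval ![f1, f2] R) = mval2 k ![a, b] R ∨
      (mval2 k ![a, b] R < ν (MvPolynomial.aeval ![f1, f2] R) ∧
        ν (MvPolynomial.aeval ![f1, f2] R)
          < ((min (((s1 : ℝ) - 1 - (s1 : ℝ) / (s2 : ℝ)) * a)
                  (((s2 : ℝ) - 1 - (s2 : ℝ) / (s1 : ℝ)) * b) : ℝ) : WithTop ℝ)) := by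
  obtain ⟨p, α, hα, hq, rfl⟩ := hν
  obtain ⟨σ, rfl, rfl⟩ := hcomp
  obtain ⟨e, he, hD⟩ := exists_le_nuSup_pderiv hα hq p σ ha
  have ha0 : a < 0 := nuSup_component_neg hα hq p σ ha
  have hs1' : (0 : ℝ) < s1 := by positivity
  have hs2' : (0 : ℝ) < s2 := by positivity
  have hb0 : b < 0 := by
    by_contra! h
    have h1 := mul_neg_of_pos_of_neg hs1' ha0
    have h2 := mul_nonneg hs2'.le h
    linarith
  intro R hR
  have hV := isValuation_nuSup (k := k) hα hq p
  have hf : ∀ i, nuSup k p α (![σ (qmk k (X 0)), σ (qmk k (X 1))] i) = (![a, b] i : ℝ) := by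
    intro i
    fin_cases i
    · exact ha
    · exact hb
  have hge : mval2 k ![a, b] R ≤ _ := polyOrd_le_map_aeval hV hf R
  have h := map_aeval_eq_or_lt hV hf (w := ![a, b]) hw he hs1 hs2 hcop ha0 hb0 hD hR
  refine or_iff_not_imp_left.2 fun hne => ⟨lt_of_le_of_ne hge (Ne.symm hne), ?_⟩
  have h1 : ((s1 : ℝ) - 1 - (s1 : ℝ) / (s2 : ℝ)) * a = s1 * a - a - b := by
    field_simp
    linear_combination -hw
  have h2 : ((s2 : ℝ) - 1 - (s2 : ℝ) / (s1 : ℝ)) * b = s1 * a - a - b := by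
    field_simp
    linear_combination (1 - (s1 : ℝ)) * hw
  rw [h1, h2, min_self]
  exact h.resolve_left hne
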